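/- In the constrained composition setup and the classification setup, assume additionally that S = sup_{x ∈ ℝ} |Ψ'(x) / (Ψ(x)(1 − Ψ(x)))| < ∞. With F = C_w = w_H ∘ ⋯ ∘ w_1, F₀ = C_{w⁰} = w⁰_H ∘ ⋯ ∘ w⁰_1, δ = δ(w, w⁰) and K_H = (1 + K_max · d_max)^H, one has V(L_F, L_{F₀}) ≤ K_H² · max(S, 1)² · δ². -/

import Mathlib

open Set MeasureTheory

/-- The cube `[-1,1]^n` in `ℝ^n`. -/
def cube (n : ℕ) : Set (Fin n → ℝ) := Set.univ.pi fun _ => Set.Icc (-1 : ℝ) 1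

/-- Iterated composition of the layer maps: `iterComp d v k = v_k ∘ ⋯ ∘ v_1` in the paper's
1-indexed notation (0-indexed layers `h = 0, …, H-1` here). -/
def iterComp (d : ℕ → ℕ) (v : ∀ h : ℕ, (Fin (d h) → ℝ) → (Fin (d (h + 1)) → ℝ)) :
    ∀ k : ℕ, (Fin (d 0) → ℝ) → (Fin (d k) → ℝ)
  | 0 => fun t => t
  | k + 1 => fun t => v k (iterComp d v k t)

/-- A bound on the partial derivatives along the coordinate directions gives a Lipschitz bound
for the sup norm on the cube. -/
theorem abs_sub_le_of_partial_bound {n : ℕ} {f : (Fin n → ℝ) → ℝ} {K : ℝ}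
    (hf : DifferentiableOn ℝ f (cube n))
    (hK : ∀ j, ∀ t ∈ cube n, |fderivWithin ℝ f (cube n) t (Pi.single j 1)| ≤ K)
    {s t : Fin n → ℝ} (hs : s ∈ cube n) (ht : t ∈ cube n) :
    |f s - f t| ≤ n * K * ‖s - t‖ := by
  rcases Nat.eq_zero_or_pos n with rfl | hn
  · simp [Subsingleton.elim s t]
  have hK0 : 0 ≤ K := (abs_nonneg _).trans (hK ⟨0, hn⟩ s hs)
  have hconv : Convex ℝ (cube n) := convex_pi fun _ _ => convex_Icc _ _
  refine hconv.norm_image_sub_le_of_norm_fderivWithin_le hf (fun x hx => ?_) ht hs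
  refine ContinuousLinearMap.opNorm_le_bound _ (by positivity) fun y => ?_
  set L := fderivWithin ℝ f (cube n) x
  have hsum : L y = ∑ j, y j * L (Pi.single j 1) := by
    conv_lhs => rw [pi_eq_sum_univ' y]
    simp [map_sum]
  calc ‖L y‖ ≤ ∑ j, ‖y j * L (Pi.single j 1)‖ := by rw [hsum]; exact norm_sum_le _ _
    _ ≤ ∑ _j : Fin n, ‖y‖ * K := by
        refine Finset.sum_le_sum fun j _ => ?_
        rw [norm_mul]
        exact mul_le_mul (norm_le_pi_norm y j) (hK j x hx) (norm_nonneg _) (norm_nonneg _)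
    _ = n * K * ‖y‖ := by simp; ring

theorem iterComp_mem_cube {H : ℕ} {d : ℕ → ℕ}
    {v : ∀ h : ℕ, (Fin (d h) → ℝ) → (Fin (d (h + 1)) → ℝ)}
    (hv : ∀ h, h + 1 < H → ∀ i, ∀ t ∈ cube (d h), |v h t i| ≤ 1)
    {t : Fin (d 0) → ℝ} (ht : t ∈ cube (d 0)) :
    ∀ k, k < H → iterComp d v k t ∈ cube (d k)
  | 0, _ => ht
  | k + 1, hk => fun i _ =>
      abs_le.1 (hv k hk i _ (iterComp_mem_cube hv ht k (by omega)))

/-- Uniform errors `δ` in each layer amplify by at most `(1 + K dmax) ^ k` after `k` layers. -/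
theorem norm_iterComp_sub_le {H : ℕ} {d : ℕ → ℕ} {dmax : ℕ} (hdmax : ∀ h, h < H → d h ≤ dmax)
    {K δ : ℝ} (hK : 0 ≤ K) (hδ0 : 0 ≤ δ)
    {v w : ∀ h : ℕ, (Fin (d h) → ℝ) → (Fin (d (h + 1)) → ℝ)}
    (hv : ∀ h, h + 1 < H → ∀ i, ∀ t ∈ cube (d h), |v h t i| ≤ 1)
    (hw : ∀ h, h + 1 < H → ∀ i, ∀ t ∈ cube (d h), |w h t i| ≤ 1)
    (hdiff : ∀ h, 1 ≤ h → h < H → ∀ i, DifferentiableOn ℝ (fun t => v h t i) (cube (d h)))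
    (hderiv : ∀ h, 1 ≤ h → h < H → ∀ i j, ∀ t ∈ cube (d h),
      |fderivWithin ℝ (fun s => v h s i) (cube (d h)) t (Pi.single j 1)| ≤ K)
    (hδ : ∀ h, h < H → ∀ i, ∀ t ∈ cube (d h), |v h t i - w h t i| ≤ δ)
    {t : Fin (d 0) → ℝ} (ht : t ∈ cube (d 0)) :
    ∀ k, k ≤ H → ‖iterComp d v k t - iterComp d w k t‖ ≤ (1 + K * dmax) ^ k * δ
  | 0, _ => by simpa [iterComp] using hδ0
  | k + 1, hk => by
    have ih := norm_iterComp_sub_le hdmax hK hδ0 hv hw hdiff hderiv hδ ht k (by omega)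
    have hv_mem := iterComp_mem_cube hv ht k hk
    have hw_mem := iterComp_mem_cube hw ht k hk
    have ha : 0 ≤ K * dmax := by positivity
    have hpow : δ ≤ (1 + K * dmax) ^ k * δ :=
      le_mul_of_one_le_left hδ0 (one_le_pow₀ (by linarith))
    refine (pi_norm_le_iff_of_nonneg (by positivity)).2 fun i => ?_
    have hlip : |v k (iterComp d v k t) i - v k (iterComp d w k t) i|
        ≤ K * dmax * ‖iterComp d v k t - iterComp d w k t‖ := by
      rcases Nat.eq_zero_or_pos k with rfl | hk0
      · simp [iterComp]
      refine (abs_sub_le_of_partial_bound (hdiff k hk0 hk i) (hderiv k hk0 hk i)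
        hv_mem hw_mem).trans ?_
      have : (d k : ℝ) ≤ dmax := by exact_mod_cast hdmax k hk
      rw [mul_comm K]
      gcongr
    calc |v k (iterComp d v k t) i - w k (iterComp d w k t) i|
        ≤ |v k (iterComp d v k t) i - v k (iterComp d w k t) i|
          + |v k (iterComp d w k t) i - w k (iterComp d w k t) i| := abs_sub_le _ _ _
      _ ≤ K * dmax * ((1 + K * dmax) ^ k * δ) + (1 + K * dmax) ^ k * δ :=
          add_le_add (hlip.trans (by gcongr)) ((hδ k hk i _ hw_mem).trans hpow)
      _ = (1 + K * dmax) ^ (k + 1) * δ := by ring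

/-- A link function with bounded `Ψ' / (Ψ (1 - Ψ))` has Lipschitz logarithm. -/
theorem abs_log_div_le {Ψ : ℝ → ℝ} (hΨ : ∀ x, Ψ x ∈ Set.Ioo (0 : ℝ) 1)
    (hdiff : Differentiable ℝ Ψ) {S : ℝ}
    (hS : ∀ x, |deriv Ψ x / (Ψ x * (1 - Ψ x))| ≤ S) (x y : ℝ) :
    |Real.log (Ψ x / Ψ y)| ≤ S * |x - y| := by
  rw [Real.log_div (hΨ x).1.ne' (hΨ y).1.ne']
  refine convex_univ.norm_image_sub_le_of_norm_hasDerivWithin_le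
    (f := fun z => Real.log (Ψ z)) (f' := fun z => deriv Ψ z / Ψ z)
    (fun z _ => ((hdiff z).hasDerivAt.log (hΨ z).1.ne').hasDerivWithinAt)
    (fun z _ => ?_) (mem_univ y) (mem_univ x)
  have h0 := (hΨ z).1
  have h1 : 0 < 1 - Ψ z := sub_pos.2 (hΨ z).2
  have heq : deriv Ψ z / Ψ z = deriv Ψ z / (Ψ z * (1 - Ψ z)) * (1 - Ψ z) := by
    field_simp
  rw [heq, norm_mul, Real.norm_of_nonneg h1.le]
  exact (mul_le_of_le_one_right (norm_nonneg _) (by linarith)).trans (hS z)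

/-- in the constrained composition and classification setups, with
`F = C_w`, `F₀ = C_{w⁰}`, `f_F = Ψ ∘ F`, `L_F(·,1) = f_F`, `L_F(·,0) = 1 - f_F`, and
`S ≥ sup |Ψ' / (Ψ (1 - Ψ))|`, one has `V(L_F, L_{F₀}) ≤ K_H² max(S,1)² δ²`. -/
theorem stmt13
    (H : ℕ) (hH : 2 ≤ H)
    (d : ℕ → ℕ) (hd : ∀ h, h ≤ H → 0 < d h) (hdH : d H = 1)
    (dmax : ℕ) (hdmax : ∀ h, h < H → d h ≤ dmax)
    (Kmax : ℝ) (hKmax : 0 < Kmax)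
    (v w : ∀ h : ℕ, (Fin (d h) → ℝ) → (Fin (d (h + 1)) → ℝ))
    (hvcont : ∀ h, h < H → ∀ i, ContinuousOn (fun t => v h t i) (cube (d h)))
    (hwcont : ∀ h, h < H → ∀ i, ContinuousOn (fun t => w h t i) (cube (d h)))
    (hvval : ∀ h, h + 1 < H → ∀ i, ∀ t ∈ cube (d h), |v h t i| ≤ 1)
    (hwval : ∀ h, h + 1 < H → ∀ i, ∀ t ∈ cube (d h), |w h t i| ≤ 1)
    (hvsmooth : ∀ h, 1 ≤ h → h < H → ∀ i, ContDiffOn ℝ 1 (fun t => v h t i) (cube (d h)))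
    (hwsmooth : ∀ h, 1 ≤ h → h < H → ∀ i, ContDiffOn ℝ 1 (fun t => w h t i) (cube (d h)))
    (hvderiv : ∀ h, 1 ≤ h → h < H → ∀ i j, ∀ t ∈ cube (d h),
      |fderivWithin ℝ (fun s => v h s i) (cube (d h)) t (Pi.single j 1)| ≤ Kmax)
    (hwderiv : ∀ h, 1 ≤ h → h < H → ∀ i j, ∀ t ∈ cube (d h),
      |fderivWithin ℝ (fun s => w h s i) (cube (d h)) t (Pi.single j 1)| ≤ Kmax)
    (δ : ℝ) (hδ : ∀ h, h < H → ∀ i, ∀ t ∈ cube (d h), |v h t i - w h t i| ≤ δ)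
    (Ψ : ℝ → ℝ) (hΨrange : ∀ x, Ψ x ∈ Set.Ioo (0 : ℝ) 1)
    (hΨdiff : Differentiable ℝ Ψ)
    (MΨ : ℝ) (hMΨ : ∀ x, |deriv Ψ x| ≤ MΨ)
    (S : ℝ) (hS : ∀ x, |deriv Ψ x / (Ψ x * (1 - Ψ x))| ≤ S)
    (μ : Measure (Fin (d 0) → ℝ)) [IsProbabilityMeasure μ]
    (hμ : μ (cube (d 0))ᶜ = 0) :
    ∀ i : Fin (d H), ∀ F G : (Fin (d 0) → ℝ) → ℝ,
      (∀ t, F t = iterComp d v H t i) → (∀ t, G t = iterComp d w H t i) →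
      (∫ u, (Ψ (F u) * (Real.log (Ψ (F u) / Ψ (G u))) ^ 2 +
            (1 - Ψ (F u)) * (Real.log ((1 - Ψ (F u)) / (1 - Ψ (G u)))) ^ 2) ∂μ)
        ≤ ((1 + Kmax * dmax) ^ H) ^ 2 * (max S 1) ^ 2 * δ ^ 2 := by
  intro i F G hF hG
  have hδ0 : 0 ≤ δ := (abs_nonneg _).trans
    (hδ 0 (by omega) ⟨0, hd 1 (by omega)⟩ 0 fun _ _ => by simp)
  have hS0 : 0 ≤ S := (abs_nonneg _).trans (hS 0)
  have hS' : ∀ x, |deriv (fun z => 1 - Ψ z) x / ((1 - Ψ x) * (1 - (1 - Ψ x)))| ≤ S := fun x => by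
    have h := hS x
    rwa [deriv_const_sub, sub_sub_cancel, mul_comm (1 - Ψ x), neg_div, abs_neg]
  have hrange' : ∀ x, 1 - Ψ x ∈ Set.Ioo (0 : ℝ) 1 := fun x =>
    ⟨sub_pos.2 (hΨrange x).2, sub_lt_self _ (hΨrange x).1⟩
  set B := ((1 + Kmax * dmax) ^ H) ^ 2 * (max S 1) ^ 2 * δ ^ 2 with hB
  have hsq : ∀ r D : ℝ, |r| ≤ S * D → 0 ≤ D → D ≤ (1 + Kmax * dmax) ^ H * δ → r ^ 2 ≤ B := by
    intro r D hr hD hD'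
    have hr' : |r| ≤ max S 1 * ((1 + Kmax * dmax) ^ H * δ) :=
      hr.trans (mul_le_mul (le_max_left _ _) hD' hD (hS0.trans (le_max_left _ _)))
    calc r ^ 2 = |r| ^ 2 := (sq_abs r).symm
      _ ≤ (max S 1 * ((1 + Kmax * dmax) ^ H * δ)) ^ 2 := by gcongr
      _ = B := by rw [hB]; ring
  have hmem : ∀ᵐ u ∂μ, u ∈ cube (d 0) := by rwa [ae_iff]
  have hbound : ∀ᵐ u ∂μ, (Ψ (F u) * (Real.log (Ψ (F u) / Ψ (G u))) ^ 2 +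
      (1 - Ψ (F u)) * (Real.log ((1 - Ψ (F u)) / (1 - Ψ (G u)))) ^ 2) ≤ B := by
    filter_upwards [hmem] with u hu
    have hFG : |F u - G u| ≤ (1 + Kmax * dmax) ^ H * δ := by
      rw [hF, hG]
      exact (norm_le_pi_norm (iterComp d v H u - iterComp d w H u) i).trans
        (norm_iterComp_sub_le hdmax hKmax.le hδ0 hvval hwval
          (fun h h1 h2 i => (hvsmooth h h1 h2 i).differentiableOn one_ne_zero)
          hvderiv hδ hu H le_rfl)
    have h1 := hsq _ _ (abs_log_div_le hΨrange hΨdiff hS (F u) (G u)) (abs_nonneg _) hFG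
    have h2 := hsq _ _ (abs_log_div_le hrange' (hΨdiff.const_sub 1) hS' (F u) (G u))
      (abs_nonneg _) hFG
    have h3 := mul_le_mul_of_nonneg_left h1 (hΨrange (F u)).1.le
    have h4 := mul_le_mul_of_nonneg_left h2 (hrange' (F u)).1.le
    linarith
  have hnonneg : 0 ≤ᵐ[μ] fun u => Ψ (F u) * (Real.log (Ψ (F u) / Ψ (G u))) ^ 2 +
      (1 - Ψ (F u)) * (Real.log ((1 - Ψ (F u)) / (1 - Ψ (G u)))) ^ 2 :=
    Filter.Eventually.of_forall fun u => add_nonneg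
      (mul_nonneg (hΨrange (F u)).1.le (sq_nonneg _))
      (mul_nonneg (hrange' (F u)).1.le (sq_nonneg _))
  simpa using integral_mono_of_nonneg hnonneg (integrable_const B) hbound
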